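/- Let m ≥ 2, k > 0, 0 < η with m·η ≤ 1, 0 < τ < 1, and b ≥ 0. Then for all π, π' ∈ Δ_{m,η} with ‖π − π'‖₂ ≤ b and every z ∈ Δ_{m,τ}, the Dirichlet densities satisfy log p_k(π, z) ≤ log p_k(π', z) + √m·b·k·log(1/τ) + (m−1)·log Γ(k·η) + log Γ(k·(1−(m−1)·η)) − m·log Γ(k/m). -/

import Mathlib

noncomputable section

/-- The η-restricted simplex Δ_{m,η} ⊆ ℝ^m. -/
def restrictedSimplex (m : ℕ) (η : ℝ) : Set (EuclideanSpace ℝ (Fin m)) :=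
  {x | (∑ i, x i) = 1 ∧ ∀ i, η ≤ x i}

/-- The Dirichlet density p_k(p, z) = Γ(k) · ∏ z_i^{k·p_i − 1} / Γ(k·p_i). -/
def dirichletDensity (m : ℕ) (k : ℝ) (p z : EuclideanSpace ℝ (Fin m)) : ℝ :=
  Real.Gamma k * ∏ i, (z i) ^ (k * p i - 1) / Real.Gamma (k * p i)

theorem aux_upper (f : ℝ → ℝ) (hf : ConvexOn ℝ (Set.Ioi 0) f) (m : ℕ)
    (k : ℝ) (hk : 0 < k) (η : ℝ) (hη : 0 < η) (hmη : (m : ℝ) * η ≤ 1)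
    (q : Fin m → ℝ) (hq1 : ∑ i, q i = 1) (hq : ∀ i, η ≤ q i) :
    ∑ i, f (k * q i) ≤ ((m : ℝ) - 1) * f (k * η) + f (k * (1 - ((m : ℝ) - 1) * η)) := by
  have hs : ∑ i, (q i - η) = 1 - m * η := by
    simp [Finset.sum_sub_distrib, hq1]
  rcases hmη.lt_or_eq with h | h
  · have hD : 0 < 1 - m * η := by linarith
    have hw1 : ∀ i, (q i - η) / (1 - m * η) ≤ 1 := by
      intro i
      rw [div_le_one hD, ← hs]
      exact Finset.single_le_sum (f := fun i => q i - η)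
        (fun j _ => sub_nonneg.2 (hq j)) (Finset.mem_univ i)
    have hM : 0 < k * (1 - ((m : ℝ) - 1) * η) := mul_pos hk (by linarith)
    have key : ∀ i, f (k * q i) ≤ f (k * η) + (q i - η) / (1 - m * η) *
        (f (k * (1 - ((m : ℝ) - 1) * η)) - f (k * η)) := by
      intro i
      have ha : 0 ≤ 1 - (q i - η) / (1 - m * η) := by linarith [hw1 i]
      have hb : 0 ≤ (q i - η) / (1 - m * η) := div_nonneg (by linarith [hq i]) hD.le
      have := hf.2 (Set.mem_Ioi.2 (mul_pos hk hη)) (Set.mem_Ioi.2 hM) ha hb (by ring)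
      simp only [smul_eq_mul] at this
      have e : (1 - (q i - η) / (1 - m * η)) * (k * η) + (q i - η) / (1 - m * η) *
          (k * (1 - ((m : ℝ) - 1) * η)) = k * q i := by
        have h3 := div_mul_cancel₀ (q i - η) hD.ne'
        linear_combination k * h3
      rw [e] at this
      linarith
    refine (Finset.sum_le_sum fun i _ => key i).trans ?_
    rw [Finset.sum_add_distrib, ← Finset.sum_mul, ← Finset.sum_div, hs, div_self hD.ne']
    simp
    linarith
  · have h0 : ∀ i, q i = η := by
      intro i
      have := (Finset.sum_eq_zero_iff_of_nonneg (s := Finset.univ) (f := fun i => q i - η)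
        (fun j _ => sub_nonneg.2 (hq j))).1 (by rw [hs, h, sub_self]) i (Finset.mem_univ i)
      linarith
    have e : 1 - ((m : ℝ) - 1) * η = η := by linarith
    rw [e]
    simp [h0]
    linarith

theorem aux_lower (f : ℝ → ℝ) (hf : ConvexOn ℝ (Set.Ioi 0) f) (m : ℕ) (hm : 2 ≤ m)
    (k : ℝ) (hk : 0 < k) (q : Fin m → ℝ) (hq1 : ∑ i, q i = 1) (hq : ∀ i, 0 < q i) :
    (m : ℝ) * f (k / m) ≤ ∑ i, f (k * q i) := by
  have hm0 : (0 : ℝ) < m := by exact_mod_cast (by omega : 0 < m)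
  have := hf.map_sum_le (t := Finset.univ) (w := fun _ : Fin m => 1 / (m : ℝ))
    (p := fun i => k * q i) (fun i _ => by positivity) (by simp [hm0.ne'])
    (fun i _ => Set.mem_Ioi.2 (mul_pos hk (hq i)))
  simp only [smul_eq_mul, ← Finset.mul_sum, hq1] at this
  have e : 1 / (m : ℝ) * (k * 1) = k / m := by ring
  rw [e] at this
  calc (m : ℝ) * f (k / m) ≤ m * (1 / m * ∑ i, f (k * q i)) := by gcongr
    _ = _ := by field_simp

theorem aux_log (m : ℕ) (k : ℝ) (hk : 0 < k) (p z : EuclideanSpace ℝ (Fin m))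
    (hp : ∀ i, 0 < p i) (hz : ∀ i, 0 < z i) :
    Real.log (dirichletDensity m k p z) = Real.log (Real.Gamma k)
      + ∑ i, ((k * p i - 1) * Real.log (z i)) - ∑ i, Real.log (Real.Gamma (k * p i)) := by
  have hG : ∀ i, 0 < Real.Gamma (k * p i) := fun i => Real.Gamma_pos_of_pos (mul_pos hk (hp i))
  have hne : ∀ i, (z i) ^ (k * p i - 1) / Real.Gamma (k * p i) ≠ 0 := fun i =>
    (div_pos (Real.rpow_pos_of_pos (hz i) _) (hG i)).ne'
  unfold dirichletDensity
  rw [Real.log_mul (Real.Gamma_pos_of_pos hk).ne' (Finset.prod_ne_zero_iff.2 fun i _ => hne i),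
    Real.log_prod (fun i _ => hne i), add_sub_assoc, ← Finset.sum_sub_distrib]
  congr 1
  refine Finset.sum_congr rfl fun i _ => ?_
  rw [Real.log_div (Real.rpow_pos_of_pos (hz i) _).ne' (hG i).ne', Real.log_rpow (hz i)]

/-- log-ratio bound on Dirichlet densities for inputs π, π' ∈ Δ_{m,η}
with ‖π − π'‖₂ ≤ b, evaluated at points of Δ_{m,τ}. -/
theorem dirichlet_density_log_ratio_bound
    (m : ℕ) (hm : 2 ≤ m) (k : ℝ) (hk : 0 < k)
    (η : ℝ) (hη : 0 < η) (hmη : (m : ℝ) * η ≤ 1)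
    (τ : ℝ) (hτ0 : 0 < τ) (hτ1 : τ < 1)
    (b : ℝ) (hb : 0 ≤ b) :
    ∀ p ∈ restrictedSimplex m η, ∀ p' ∈ restrictedSimplex m η, ‖p - p'‖ ≤ b →
      ∀ z ∈ restrictedSimplex m τ,
        Real.log (dirichletDensity m k p z) ≤
          Real.log (dirichletDensity m k p' z)
            + Real.sqrt m * b * k * Real.log (1 / τ)
            + ((m : ℝ) - 1) * Real.log (Real.Gamma (k * η))
            + Real.log (Real.Gamma (k * (1 - ((m : ℝ) - 1) * η)))
            - (m : ℝ) * Real.log (Real.Gamma (k / m)) := by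
  intro p hp p' hp' hpp z hz
  have hp0 : ∀ i, 0 < p i := fun i => hη.trans_le (hp.2 i)
  have hp0' : ∀ i, 0 < p' i := fun i => hη.trans_le (hp'.2 i)
  have hz0 : ∀ i, 0 < z i := fun i => hτ0.trans_le (hz.2 i)
  rw [aux_log m k hk p z hp0 hz0, aux_log m k hk p' z hp0' hz0]
  have hU := aux_upper _ Real.convexOn_log_Gamma m k hk η hη hmη p' hp'.1 hp'.2
  have hL := aux_lower _ Real.convexOn_log_Gamma m hm k hk p hp.1 hp0
  simp only [Function.comp_apply] at hU hL
  have hlog0 : 0 ≤ Real.log (1 / τ) := Real.log_nonneg (by rw [le_div_iff₀ hτ0]; linarith)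
  have hlz : ∀ i, |Real.log (z i)| ≤ Real.log (1 / τ) := by
    intro i
    have h1 : z i ≤ 1 := by
      rw [← hz.1]
      exact Finset.single_le_sum (f := fun i => z i) (fun j _ => (hz0 j).le) (Finset.mem_univ i)
    rw [abs_of_nonpos (Real.log_nonpos (hz0 i).le h1), one_div, Real.log_inv]
    exact neg_le_neg (Real.log_le_log hτ0 (hz.2 i))
  have hCS : ∑ i, |p i - p' i| ≤ Real.sqrt m * b := by
    have h1 : (∑ i, |p i - p' i|) ^ 2 ≤ m * ∑ i, |p i - p' i| ^ 2 := by
      simpa using sq_sum_le_card_mul_sum_sq (s := Finset.univ) (f := fun i => |p i - p' i|)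
    have h2 : ∑ i, |p i - p' i| ^ 2 = ‖p - p'‖ ^ 2 := by
      rw [EuclideanSpace.norm_sq_eq]
      simp
    have h3 : ‖p - p'‖ ^ 2 ≤ b ^ 2 := by gcongr
    refine (abs_le_of_sq_le_sq' ?_ (by positivity)).2
    rw [mul_pow, Real.sq_sqrt (Nat.cast_nonneg m)]
    rw [h2] at h1
    exact h1.trans (by gcongr)
  have hmain : ∑ i, ((k * p i - 1) * Real.log (z i)) - ∑ i, ((k * p' i - 1) * Real.log (z i))
      ≤ Real.sqrt m * b * k * Real.log (1 / τ) := by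
    rw [← Finset.sum_sub_distrib]
    calc _ ≤ ∑ i, |p i - p' i| * (k * Real.log (1 / τ)) := by
          refine Finset.sum_le_sum fun i _ => ?_
          have : (k * p i - 1) * Real.log (z i) - (k * p' i - 1) * Real.log (z i)
            = k * ((p i - p' i) * Real.log (z i)) := by ring
          rw [this]
          calc _ ≤ k * (|p i - p' i| * |Real.log (z i)|) := by
                rw [← abs_mul]; gcongr; exact le_abs_self _
            _ ≤ k * (|p i - p' i| * Real.log (1 / τ)) := by gcongr; exact hlz i
            _ = _ := by ring
      _ = (∑ i, |p i - p' i|) * (k * Real.log (1 / τ)) := by rw [Finset.sum_mul]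
      _ ≤ Real.sqrt m * b * (k * Real.log (1 / τ)) := by gcongr
      _ = _ := by ring
  linarith

end
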